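/- For r = 7, the number of (−1)-classes is exactly 56: the set {E ∈ ℤ^8 : (E,E) = −1 and (E,K_7) = −1} has exactly 56 elements. -/

import Mathlib

/-- The intersection form on `Pic = ℤ^8` with basis `H = e₀`, `E_1,…,E_7`:
`(H,H) = 1`, `(E_i,E_i) = −1`, all other products of distinct basis vectors `0`. -/
def ip (v w : Fin 8 → ℤ) : ℤ := v 0 * w 0 - ∑ i ∈ Finset.univ.erase 0, v i * w i

/-- The canonical class `K_7 = −3H + E_1 + ⋯ + E_7`. -/
def K7 : Fin 8 → ℤ := fun i => if i = 0 then -3 else 1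

/-- A `(−1)`-class: `(E,E) = −1` and `(E,K_7) = −1`. -/
def isClass (E : Fin 8 → ℤ) : Prop := ip E E = -1 ∧ ip E K7 = -1

theorem ip_eq_sum_succ (v w : Fin 8 → ℤ) :
    ip v w = v 0 * w 0 - ∑ i : Fin 7, v i.succ * w i.succ := by
  have h := Finset.add_sum_erase Finset.univ (fun i => v i * w i) (Finset.mem_univ 0)
  rw [Fin.sum_univ_succ] at h
  rw [ip, add_left_cancel h]

theorem isClass_iff (E : Fin 8 → ℤ) :
    isClass E ↔ ∑ i : Fin 7, E i.succ ^ 2 = E 0 ^ 2 + 1 ∧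
      ∑ i : Fin 7, E i.succ = 1 - 3 * E 0 := by
  simp only [isClass, ip_eq_sum_succ, K7, Fin.succ_ne_zero, if_true, if_false, mul_one, ← sq]
  constructor <;> rintro ⟨h₁, h₂⟩ <;> constructor <;> linarith

theorem isClass.degree_bounds {E : Fin 8 → ℤ} (h : isClass E) : 0 ≤ E 0 ∧ E 0 ≤ 3 := by
  obtain ⟨h₁, h₂⟩ := (isClass_iff E).1 h
  have hcs := sq_sum_le_card_mul_sum_sq (s := Finset.univ) (f := fun i : Fin 7 => E i.succ)
  simp only [h₁, h₂, Finset.card_univ, Fintype.card_fin, Nat.cast_ofNat] at hcs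
  constructor <;> by_contra! hlt <;> nlinarith

/-- The smaller of the two consecutive values taken by the `E_i`-coordinates of a `(−1)`-class
of degree `d`. -/
def lowCoeff : Fin 4 → ℤ := ![0, -1, -1, -2]

/-- The number of `E_i`-coordinates of a `(−1)`-class of degree `d` that exceed `lowCoeff d`. -/
def highCount : Fin 4 → ℕ := ![1, 5, 2, 6]

/-- The class of degree `d` whose `E_i`-coordinate is `lowCoeff d + 1` for `i` in the given
subset and `lowCoeff d` otherwise. -/
def classOfSubset (p : (_ : Fin 4) × Finset (Fin 7)) : Fin 8 → ℤ :=
  Fin.cons (p.1.val : ℤ) fun i => lowCoeff p.1 + if i ∈ p.2 then 1 else 0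

theorem classOfSubset_injective : Function.Injective classOfSubset := by
  rintro ⟨d, s⟩ ⟨d', s'⟩ h
  obtain ⟨hd, hs⟩ := Fin.cons_inj.1 h
  obtain rfl : d = d' := Fin.ext (by exact_mod_cast hd)
  congr 1
  ext i
  have hi := congrFun hs i
  by_cases h₁ : i ∈ s <;> by_cases h₂ : i ∈ s' <;> simp_all

theorem isClass_classOfSubset (d : Fin 4) (s : Finset (Fin 7)) (hs : s.card = highCount d) :
    isClass (classOfSubset ⟨d, s⟩) := by
  have hsq (i : Fin 7) : (lowCoeff d + if i ∈ s then 1 else 0) ^ 2 =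
      lowCoeff d ^ 2 + (2 * lowCoeff d + 1) * if i ∈ s then 1 else 0 := by
    split_ifs <;> ring
  simp only [isClass_iff, classOfSubset, Fin.cons_zero, Fin.cons_succ, hsq,
    Finset.sum_add_distrib, ← Finset.mul_sum, Finset.sum_const, Finset.sum_boole,
    Finset.filter_univ_mem, hs]
  fin_cases d <;> simp [lowCoeff, highCount]

theorem isClass.exists_classOfSubset {E : Fin 8 → ℤ} (h : isClass E) :
    ∃ (d : Fin 4) (s : Finset (Fin 7)), s.card = highCount d ∧ classOfSubset ⟨d, s⟩ = E := by
  obtain ⟨h₁, h₂⟩ := (isClass_iff E).1 h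
  obtain ⟨hd₀, hd₃⟩ := h.degree_bounds
  obtain ⟨d, hd⟩ : ∃ d : Fin 4, (d.val : ℤ) = E 0 := ⟨⟨(E 0).toNat, by omega⟩, by simp [hd₀]⟩
  rw [← hd] at h₁ h₂
  have hzero : ∑ i : Fin 7, (E i.succ - lowCoeff d) * (E i.succ - lowCoeff d - 1) = 0 := by
    have hexp (i : Fin 7) : (E i.succ - lowCoeff d) * (E i.succ - lowCoeff d - 1) =
        E i.succ ^ 2 - (2 * lowCoeff d + 1) * E i.succ + lowCoeff d * (lowCoeff d + 1) := by
      ring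
    simp only [hexp, Finset.sum_add_distrib, Finset.sum_sub_distrib, ← Finset.mul_sum, h₁, h₂]
    clear * -
    fin_cases d <;> simp [lowCoeff]
  have hnonneg (x : ℤ) : 0 ≤ x * (x - 1) := by
    rcases le_or_gt x 0 with hx | hx <;> nlinarith
  have hcoord (i : Fin 7) : E i.succ = lowCoeff d ∨ E i.succ = lowCoeff d + 1 := by
    have hi := (Finset.sum_eq_zero_iff_of_nonneg fun i _ => hnonneg _).1 hzero i
      (Finset.mem_univ i)
    rcases mul_eq_zero.1 hi with hi | hi
    · left; linarith
    · right; linarith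
  set s : Finset (Fin 7) := {i | E i.succ = lowCoeff d + 1} with hs
  have heq (i : Fin 7) : E i.succ = lowCoeff d + if i ∈ s then 1 else 0 := by
    rcases hcoord i with hi | hi <;> simp [hs, hi]
  refine ⟨d, s, ?_, ?_⟩
  · simp only [heq, Finset.sum_add_distrib, Finset.sum_const, Finset.sum_boole,
      Finset.filter_univ_mem] at h₂
    clear * - h₂
    clear_value s
    fin_cases d <;> simp [lowCoeff, highCount] at h₂ ⊢ <;> omega
  · funext i
    refine Fin.cases ?_ (fun j => ?_) i
    · exact hd
    · exact (heq j).symm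

theorem setOf_isClass_eq_image : {E | isClass E} = classOfSubset ''
    (Finset.univ.sigma fun d => Finset.powersetCard (highCount d) Finset.univ :
      Finset ((_ : Fin 4) × Finset (Fin 7))) := by
  ext E
  simp only [Set.mem_ofPred_eq, Set.mem_image, Finset.mem_coe, Finset.mem_sigma,
    Finset.mem_univ, true_and, Finset.mem_powersetCard_univ]
  constructor
  · intro h
    obtain ⟨d, s, hs, hE⟩ := h.exists_classOfSubset
    exact ⟨⟨d, s⟩, hs, hE⟩
  · rintro ⟨⟨d, s⟩, hs, rfl⟩
    exact isClass_classOfSubset d s hs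

theorem statement13 : {E : Fin 8 → ℤ | isClass E}.ncard = 56 := by
  rw [setOf_isClass_eq_image, Set.ncard_image_of_injective _ classOfSubset_injective,
    Set.ncard_coe_finset, Finset.card_sigma]
  simp only [Finset.card_powersetCard, Finset.card_univ, Fintype.card_fin]
  decide
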